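/- Let L be a first-order language, let A be a finite L-structure, and let C and C' be L-structures that are both cores of A: there are homomorphisms r : A → C, e : C → A with r ∘ e = id_C and r' : A → C', e' : C' → A with r' ∘ e' = id_{C'}, and every endomorphism of C is injective and every endomorphism of C' is injective. Then C and C' are isomorphic L-structures. -/

import Mathlib

open FirstOrder FirstOrder.Language

/-- The iterates of an endomorphism are endomorphisms. -/
theorem FirstOrder.Language.Hom.exists_coe_eq_iterate {L : FirstOrder.Language} {M : Type*}
    [L.Structure M] (h : M →[L] M) (n : ℕ) : ∃ k : M →[L] M, ⇑k = h^[n] := by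
  induction n with
  | zero => exact ⟨Hom.id L M, rfl⟩
  | succ n ih =>
    obtain ⟨k, hk⟩ := ih
    exact ⟨k.comp h, by rw [Function.iterate_succ, ← hk]; rfl⟩

/-- An injective endomorphism of a finite structure has a left inverse homomorphism. -/
theorem FirstOrder.Language.Hom.exists_comp_eq_id_of_injective {L : FirstOrder.Language}
    {M : Type*} [L.Structure M] [Finite M] (h : M →[L] M) (hh : Function.Injective h) :
    ∃ k : M →[L] M, k.comp h = Hom.id L M := by
  let σ : Equiv.Perm M := Equiv.ofBijective h (Finite.injective_iff_bijective.mp hh)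
  obtain ⟨n, hn, hσ⟩ := isOfFinOrder_iff_pow_eq_one.mp (isOfFinOrder_of_finite σ)
  obtain ⟨k, hk⟩ := h.exists_coe_eq_iterate (n - 1)
  refine ⟨k, Hom.ext fun x => ?_⟩
  rw [Hom.comp_apply, hk, ← Function.iterate_succ_apply, Nat.succ_eq_add_one,
    Nat.sub_add_cancel hn]
  change σ^[n] x = x
  rw [Equiv.Perm.iterate_eq_pow, hσ, Equiv.Perm.one_apply]

/-- If `C` and `C'` are both cores of a finite `L`-structure `A` (retracts of `A` all of
whose endomorphisms are injective), then `C` and `C'` are isomorphic: there are mutually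
inverse homomorphisms between them. -/
theorem stmt_8 {L : FirstOrder.Language} {A C C' : Type*}
    [L.Structure A] [L.Structure C] [L.Structure C'] [Finite A]
    (r : A →[L] C) (e : C →[L] A) (hre : r.comp e = Hom.id L C)
    (r' : A →[L] C') (e' : C' →[L] A) (hre' : r'.comp e' = Hom.id L C')
    (hC : ∀ h : C →[L] C, Function.Injective h)
    (hC' : ∀ h : C' →[L] C', Function.Injective h) :
    ∃ (f : C →[L] C') (g : C' →[L] C), g.comp f = Hom.id L C ∧ f.comp g = Hom.id L C' := by
  have he : Function.Injective e :=
    Function.LeftInverse.injective (g := r) fun x => DFunLike.congr_fun hre x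
  have he' : Function.Injective e' :=
    Function.LeftInverse.injective (g := r') fun x => DFunLike.congr_fun hre' x
  have : Finite C := Finite.of_injective e he
  have : Finite C' := Finite.of_injective e' he'
  let f : C →[L] C' := r'.comp e
  let u : C' →[L] C := r.comp e'
  obtain ⟨k, hk⟩ := (u.comp f).exists_comp_eq_id_of_injective (hC _)
  have hf : Function.Surjective f :=
    Function.Surjective.of_comp (g := u)
      (Finite.surjective_of_injective (hC' (f.comp u)))
  have hgf : (k.comp u).comp f = Hom.id L C := by rw [Hom.comp_assoc, hk]
  refine ⟨f, k.comp u, hgf, Hom.ext fun y => ?_⟩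
  obtain ⟨x, rfl⟩ := hf y
  exact congrArg f (DFunLike.congr_fun hgf x)
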